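/- arXiv:2411.07661 — 2 statements merged into one kernel-verified Lean document; each statement's English description precedes it below -/
import Mathlib

section
/- Under the hypotheses of the global convergence theorem for the algorithm with û^n = u^n, let (u^n)_n converge to u*, and assume A(x,y) = E(x) + (L/2 + 1/(3δt))‖x − y‖² is a KL function with exponent θ ∈ (1/2, 1). Then there exist constants c₂ > 0 and n₂ > 0 such that ‖u^n − u*‖ ≤ c₂ n^{−(1−θ)/(2θ−1)} for all n > n₂ (local sublinear convergence). -/
open scoped RealInnerProductSpace
open Filter Topology

section Gradient

variable {X : Type*} [NormedAddCommGroup X] [InnerProductSpace ℝ X] [CompleteSpace X]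

theorem HasGradientAt.hasDerivAt_add_smul {F : X → ℝ} {g x d : X} {t : ℝ}
    (hF : HasGradientAt F g (x + t • d)) :
    HasDerivAt (fun s : ℝ => F (x + s • d)) ⟪g, d⟫ t := by
  have h1 : HasDerivAt (fun s : ℝ => x + s • d) d t := by
    simpa using ((hasDerivAt_id t).smul_const d).const_add x
  have := (hasGradientAt_iff_hasFDerivAt.1 hF).comp_hasDerivAt t h1
  rwa [InnerProductSpace.toDual_apply_apply] at this

/-- The descent lemma for functions with Lipschitz gradient. -/
theorem le_add_inner_add_sq_of_lipschitz_gradient {F : X → ℝ} {f : X → X}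
    (hF : ∀ x, HasGradientAt F (f x) x) {L : ℝ}
    (hLip : ∀ x y, ‖f x - f y‖ ≤ L * ‖x - y‖) (x d : X) :
    F (x + d) ≤ F x + ⟪f x, d⟫ + L / 2 * ‖d‖ ^ 2 := by
  let φ : ℝ → ℝ := fun t => F (x + t • d) - t * ⟪f x, d⟫ - L / 2 * ‖d‖ ^ 2 * t ^ 2
  have hφ : ∀ t, HasDerivAt φ (⟪f (x + t • d), d⟫ - ⟪f x, d⟫ - L * ‖d‖ ^ 2 * t) t := by
    intro t
    have h2 : HasDerivAt (fun t : ℝ => t * ⟪f x, d⟫) ⟪f x, d⟫ t := by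
      simpa using (hasDerivAt_id t).mul_const ⟪f x, d⟫
    have h3 : HasDerivAt (fun t : ℝ => L / 2 * ‖d‖ ^ 2 * t ^ 2) (L * ‖d‖ ^ 2 * t) t :=
      ((hasDerivAt_pow 2 t).const_mul (L / 2 * ‖d‖ ^ 2)).congr_deriv (by norm_num; ring)
    exact ((hF _).hasDerivAt_add_smul.sub h2).sub h3
  have hanti : AntitoneOn φ (Set.Icc 0 1) := by
    refine antitoneOn_of_hasDerivWithinAt_nonpos (convex_Icc 0 1)
      (fun t _ => (hφ t).continuousAt.continuousWithinAt)
      (fun t _ => (hφ t).hasDerivWithinAt) fun t ht => ?_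
    rw [interior_Icc] at ht
    have h1 : ⟪f (x + t • d) - f x, d⟫ ≤ L * ‖t • d‖ * ‖d‖ := by
      refine (real_inner_le_norm _ _).trans ?_
      gcongr
      simpa using hLip (x + t • d) x
    rw [norm_smul, Real.norm_of_nonneg ht.1.le, inner_sub_left] at h1
    nlinarith
  have := hanti (by simp) (by simp) zero_le_one
  simp only [φ, one_smul, zero_smul, add_zero] at this
  linarith

theorem ConvexOn.add_inner_gradient_le {H : X → ℝ} (hconv : ConvexOn ℝ Set.univ H) {g x : X}
    (hH : HasGradientAt H g x) (y : X) : H x + ⟪g, y - x⟫ ≤ H y := by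
  have hc : ConvexOn ℝ Set.univ (fun t : ℝ => H (x + t • (y - x))) := by
    have := hconv.comp_affineMap (AffineMap.lineMap x y : ℝ →ᵃ[ℝ] X)
    simpa [Function.comp_def, AffineMap.lineMap_apply, add_comm] using this
  have hd : HasDerivAt (fun t : ℝ => H (x + t • (y - x))) ⟪g, y - x⟫ 0 :=
    HasGradientAt.hasDerivAt_add_smul (by simpa using hH)
  have := hc.le_slope_of_hasDerivAt (Set.mem_univ 0) (Set.mem_univ 1) zero_lt_one hd
  simp [slope_def_field] at this
  linarith

theorem hasGradientAt_mul_norm_sub_sq (c : ℝ) (a x : X) :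
    HasGradientAt (fun v => c * ‖v - a‖ ^ 2) ((2 * c) • (x - a)) x := by
  rw [hasGradientAt_iff_hasFDerivAt]
  have := (((hasFDerivAt_id x).sub_const a).norm_sq).const_mul c
  refine this.congr_fderiv ?_
  ext v
  simp
  ring

theorem hasGradientAt_inner_sub (p a x : X) :
    HasGradientAt (fun v => ⟪p, v - a⟫) p x := by
  rw [hasGradientAt_iff_hasFDerivAt]
  have := (InnerProductSpace.toDual ℝ X p).hasFDerivAt.comp x ((hasFDerivAt_id x).sub_const a)
  exact this.congr_fderiv (by ext v; simp)

theorem HasGradientAt.add {F G : X → ℝ} {f g x : X} (hF : HasGradientAt F f x)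
    (hG : HasGradientAt G g x) : HasGradientAt (fun v => F v + G v) (f + g) x := by
  rw [hasGradientAt_iff_hasFDerivAt] at *
  rw [map_add]
  exact hF.add hG

theorem HasGradientAt.sub {F G : X → ℝ} {f g x : X} (hF : HasGradientAt F f x)
    (hG : HasGradientAt G g x) : HasGradientAt (fun v => F v - G v) (f - g) x := by
  rw [hasGradientAt_iff_hasFDerivAt] at *
  rw [map_sub]
  exact hF.sub hG

theorem hasGradientAt_fst_add_mul_norm_sub_sq {E : X → ℝ} {g : X} (k : ℝ) (p : WithLp 2 (X × X))
    (hE : HasGradientAt E g p.fst) :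
    HasGradientAt (fun q : WithLp 2 (X × X) => E q.fst + k * ‖q.fst - q.snd‖ ^ 2)
      (WithLp.toLp 2 (g + (2 * k) • (p.fst - p.snd), -((2 * k) • (p.fst - p.snd)))) p := by
  rw [hasGradientAt_iff_hasFDerivAt] at *
  have h1 : HasFDerivAt (fun q : WithLp 2 (X × X) => q.fst) (WithLp.fstL 2 ℝ X X) p :=
    (WithLp.fstL 2 ℝ X X).hasFDerivAt
  have h2 : HasFDerivAt (fun q : WithLp 2 (X × X) => q.snd) (WithLp.sndL 2 ℝ X X) p :=
    (WithLp.sndL 2 ℝ X X).hasFDerivAt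
  have := (hE.comp p h1).add (((h1.sub h2).norm_sq).const_mul k)
  refine this.congr_fderiv ?_
  ext v
  simp [WithLp.prod_inner_apply, inner_add_left, inner_smul_left, inner_sub_left]
  ring

end Gradient

theorem WithLp.norm_toLp_prod_le {X : Type*} [NormedAddCommGroup X] (x y : X) : ‖WithLp.toLp 2 (x, y)‖ ≤ ‖x‖ + ‖y‖ := by
  refine (pow_le_pow_iff_left₀ (norm_nonneg _) (by positivity) two_ne_zero).1 ?_
  rw [WithLp.prod_norm_sq_eq_of_L2]
  simp only [WithLp.toLp_fst, WithLp.toLp_snd]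
  nlinarith [norm_nonneg x, norm_nonneg y]


section OneStep

variable {X : Type*} [NormedAddCommGroup X] [InnerProductSpace ℝ X]

/-- One step of the algorithm decreases the Lyapunov function, where `d = y - u`,
`b = u - u_prev`, and `e = 1 / (3 δt)`. -/
theorem lyapunov_decrease {d b p q g m : X} {e L lam α σ Hu Hy Fu Fy Ep : ℝ}
    (he : 0 ≤ e) (hL : 0 ≤ L) (hα : 0 ≤ α) (hlam : 0 ≤ lam)
    (hσ : (σ + L) * (1 + lam) ^ 2 ≤ 4 * e - L / 2)
    (hopt : g + (6 * e) • d - ((2 * e) • b - p - (p - q)) + m = 0) (hm : 0 ≤ ⟪m, d⟫)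
    (hH : Hy - ⟪g, d⟫ ≤ Hu) (hF : Fy ≤ Fu + ⟪p, d⟫ + L / 2 * ‖d‖ ^ 2)
    (hpq : ‖p - q‖ ≤ L * ‖b‖)
    (hls : Ep + 3 * e * ‖(1 + lam) • d‖ ^ 2
        - (e * ‖(1 + lam) • d + b‖ ^ 2 - ⟪p - q, (1 + lam) • d + b⟫)
      ≤ Hy + Fy + 3 * e * ‖d‖ ^ 2 - (e * ‖d + b‖ ^ 2 - ⟪p - q, d + b⟫)
        - α * lam * ‖d‖ ^ 2) :
    Ep + (L / 2 + e) * ‖(1 + lam) • d‖ ^ 2 + σ * ‖(1 + lam) • d‖ ^ 2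
      ≤ Hu + Fu + (L / 2 + e) * ‖b‖ ^ 2 := by
  have h1 : ⟪g + (6 * e) • d - ((2 * e) • b - p - (p - q)) + m, d⟫ = 0 := by simp [hopt]
  simp only [inner_add_left, inner_sub_left, real_inner_smul_left,
    real_inner_self_eq_norm_sq] at h1
  have hsum : ‖(1 + lam) • d + b‖ ^ 2 ≤ 2 * ‖(1 + lam) • d‖ ^ 2 + 2 * ‖b‖ ^ 2 := by
    nlinarith [parallelogram_law_with_norm ℝ ((1 + lam) • d) b,
      sq_nonneg ‖(1 + lam) • d - b‖]
  have hin : -(L / 2 * (‖(1 + lam) • d‖ ^ 2 + ‖b‖ ^ 2)) ≤ ⟪p - q, (1 + lam) • d⟫ := by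
    have h2 := (abs_le.1 (abs_real_inner_le_norm (p - q) ((1 + lam) • d))).1
    have h3 : ‖p - q‖ * ‖(1 + lam) • d‖ ≤ L * ‖b‖ * ‖(1 + lam) • d‖ := by gcongr
    nlinarith [mul_nonneg hL (sq_nonneg (‖b‖ - ‖(1 + lam) • d‖))]
  have hn : ‖(1 + lam) • d‖ ^ 2 = (1 + lam) ^ 2 * ‖d‖ ^ 2 := by
    rw [norm_smul, mul_pow, Real.norm_eq_abs, sq_abs]
  have hsum' := mul_le_mul_of_nonneg_left hsum he
  have hσ' := mul_le_mul_of_nonneg_right hσ (sq_nonneg ‖d‖)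
  have hαd : 0 ≤ α * lam * ‖d‖ ^ 2 := by positivity
  rw [norm_add_sq_real d b] at hls
  simp only [inner_add_right, inner_sub_left] at hls hin
  rw [real_inner_comm d b] at h1
  rw [hn] at *
  linarith

/-- The gradient of the energy at the new iterate is controlled by the last two increments. -/
theorem norm_gradient_le_of_step {d b p q g gp fp : X} {M : X →L[ℝ] X} {e L Lh lam : ℝ}
    (he : 0 ≤ e) (hLh : 0 ≤ Lh) (hlam : 0 ≤ lam)
    (hopt : g + (6 * e) • d - ((2 * e) • b - p - (p - q)) + M d = 0)
    (hg : ‖gp - g‖ ≤ Lh * ‖lam • d‖) (hp : ‖fp - p‖ ≤ L * ‖(1 + lam) • d‖)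
    (hpq : ‖p - q‖ ≤ L * ‖b‖) :
    ‖gp + fp‖ ≤ (Lh + L + 6 * e + ‖M‖) * ‖(1 + lam) • d‖ + (L + 2 * e) * ‖b‖ := by
  have hd : ‖d‖ ≤ ‖(1 + lam) • d‖ := by
    rw [norm_smul, Real.norm_of_nonneg (by linarith)]
    nlinarith [norm_nonneg d]
  have hld : ‖lam • d‖ ≤ ‖(1 + lam) • d‖ := by
    rw [norm_smul, norm_smul, Real.norm_of_nonneg hlam, Real.norm_of_nonneg (by linarith)]
    nlinarith [norm_nonneg d]
  have key : gp + fp = (gp - g) + (fp - p) - (p - q) - (6 * e) • d + (2 * e) • b - M d := by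
    rw [← sub_eq_zero, ← hopt]
    abel
  have h6 : ‖(6 * e) • d‖ ≤ 6 * e * ‖(1 + lam) • d‖ := by
    rw [norm_smul, Real.norm_of_nonneg (by positivity)]
    gcongr
  have h2 : ‖(2 * e) • b‖ = 2 * e * ‖b‖ := by
    rw [norm_smul, Real.norm_of_nonneg (by positivity)]
  have hM : ‖M d‖ ≤ ‖M‖ * ‖(1 + lam) • d‖ := (M.le_opNorm d).trans (by gcongr)
  have hg' : ‖gp - g‖ ≤ Lh * ‖(1 + lam) • d‖ := hg.trans (by gcongr)
  rw [key]
  linarith [norm_sub_le ((gp - g) + (fp - p) - (p - q) - (6 * e) • d + (2 * e) • b) (M d),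
    norm_add_le ((gp - g) + (fp - p) - (p - q) - (6 * e) • d) ((2 * e) • b),
    norm_sub_le ((gp - g) + (fp - p) - (p - q)) ((6 * e) • d),
    norm_sub_le ((gp - g) + (fp - p)) (p - q), norm_add_le (gp - g) (fp - p)]

end OneStep

/-- If `r (n+2) ^ (1+β) ≤ D (r n - r (n+2))` eventually, `r` decays like `n ^ (-1/β)`. -/
theorem exists_le_mul_rpow_of_rpow_le_sub {r : ℕ → ℝ} (hr : Antitone r)
    {β D : ℝ} (hβ : 0 < β) (hβ1 : β ≤ 1) (hD : 0 < D) {N : ℕ} (hN : 1 ≤ N)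
    (hrec : ∀ n, N ≤ n → r (n + 2) ^ (1 + β) ≤ D * (r n - r (n + 2))) :
    ∃ C : ℝ, 0 < C ∧ ∀ n : ℕ, N ≤ n → r n ≤ C * (n : ℝ) ^ (-(1 / β)) := by
  set γ := 1 / β with hγ
  have hγ1 : 1 ≤ γ := by rw [hγ, le_div_iff₀ hβ]; linarith
  have hγ0 : 0 < γ := by linarith
  have hγβ : γ * β = 1 := by rw [hγ]; field_simp
  set B := 2 * γ * D * 3 ^ γ with hB
  have hBpos : 0 < B := by positivity
  set C := max (B ^ γ) (r N * ((N : ℝ) + 1) ^ γ) with hC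
  have hCpos : 0 < C := lt_of_lt_of_le (by positivity) (le_max_left _ _)
  have hCβ : B ≤ C ^ β := by
    calc B = (B ^ γ) ^ β := by rw [← Real.rpow_mul hBpos.le, hγβ, Real.rpow_one]
      _ ≤ C ^ β := Real.rpow_le_rpow (by positivity) (le_max_left _ _) hβ.le
  have hbase : r N ≤ C * ((N : ℝ) + 1) ^ (-γ) := by
    rw [Real.rpow_neg (by positivity), ← div_eq_mul_inv, le_div_iff₀ (by positivity)]
    exact le_max_right _ _
  refine ⟨C, hCpos, ?_⟩
  have step : ∀ n : ℕ, N ≤ n → r n ≤ C * (n : ℝ) ^ (-γ) →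
      r (n + 2) ≤ C * ((n : ℝ) + 2) ^ (-γ) := by
    intro n hn hrn
    by_contra! hlt
    have hn1 : (1 : ℝ) ≤ n := by exact_mod_cast hN.trans hn
    have hn0 : (0 : ℝ) < n := by linarith
    have h1 : (C * ((n : ℝ) + 2) ^ (-γ)) ^ (1 + β) ≤ r (n + 2) ^ (1 + β) :=
      Real.rpow_le_rpow (by positivity) hlt.le (by linarith)
    have h2 := hrec n hn
    have hbern : 1 - 2 * γ / ((n : ℝ) + 2) ≤ ((n : ℝ) / (n + 2)) ^ γ := by
      have := one_add_mul_self_le_rpow_one_add (s := -(2 / ((n : ℝ) + 2)))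
        (by rw [neg_le_neg_iff, div_le_one (by positivity)]; linarith) hγ1
      have e : 1 + -(2 / ((n : ℝ) + 2)) = n / (n + 2) := by field_simp; ring
      rw [e] at this
      calc _ = 1 + γ * -(2 / ((n : ℝ) + 2)) := by ring
        _ ≤ _ := this
    have hq : ((n : ℝ) + 2) ^ γ ≤ 3 ^ γ * (n : ℝ) ^ γ := by
      rw [← Real.mul_rpow (by norm_num) hn0.le]
      exact Real.rpow_le_rpow (by positivity) (by linarith) hγ0.le
    rw [Real.div_rpow hn0.le (by positivity)] at hbern
    rw [Real.mul_rpow hCpos.le (by positivity), ← Real.rpow_mul (by positivity),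
      Real.rpow_add hCpos, Real.rpow_one] at h1
    have e2 : -γ * (1 + β) = -γ + -1 := by linear_combination -hγβ
    rw [e2, Real.rpow_add (by positivity), Real.rpow_neg_one, Real.rpow_neg (by positivity)] at h1
    rw [Real.rpow_neg hn0.le] at hrn
    rw [Real.rpow_neg (by positivity)] at hlt
    set P := (n : ℝ) ^ γ with hP
    set Q := ((n : ℝ) + 2) ^ γ with hQ
    have hPpos : 0 < P := by positivity
    have hQpos : 0 < Q := by positivity
    have h3 : C * C ^ β * (Q⁻¹ * ((n : ℝ) + 2)⁻¹) < D * (C * P⁻¹ - C * Q⁻¹) := by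
      exact (h1.trans h2).trans_lt (mul_lt_mul_of_pos_left (by linarith) hD)
    have h4 : P⁻¹ - Q⁻¹ ≤ P⁻¹ * (2 * γ / ((n : ℝ) + 2)) := by
      have : P⁻¹ * (1 - 2 * γ / ((n : ℝ) + 2)) ≤ P⁻¹ * (P / Q) := by gcongr
      have e3 : P⁻¹ * (P / Q) = Q⁻¹ := by field_simp
      rw [e3] at this
      linarith
    have h5 : C * C ^ β * (Q⁻¹ * ((n : ℝ) + 2)⁻¹) < D * C * (P⁻¹ * (2 * γ / ((n : ℝ) + 2))) :=
      h3.trans_le (by rw [← mul_sub, ← mul_assoc]; gcongr)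
    have h6 : C ^ β * P < 2 * γ * D * Q := by
      field_simp at h5
      nlinarith
    have h7 : 2 * γ * D * Q ≤ B * P := by
      rw [hB]
      calc 2 * γ * D * Q ≤ 2 * γ * D * (3 ^ γ * P) := by gcongr
        _ = _ := by ring
    nlinarith
  have key : ∀ k : ℕ, r (N + k) ≤ C * ((N + k : ℕ) : ℝ) ^ (-γ) ∧
      r (N + k + 1) ≤ C * ((N + k + 1 : ℕ) : ℝ) ^ (-γ) := by
    intro k
    induction k with
    | zero =>
      constructor
      · refine hbase.trans ?_
        have : (0 : ℝ) < N := by exact_mod_cast hN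
        rw [add_zero]
        refine mul_le_mul_of_nonneg_left ?_ hCpos.le
        exact Real.rpow_le_rpow_of_nonpos this (by linarith) (by linarith)
      · refine (hr (Nat.le_succ _)).trans ?_
        simpa using hbase
    | succ k ih =>
      refine ⟨ih.2, ?_⟩
      have := step (N + k) (by omega) ih.1
      have e : ((N + (k + 1) + 1 : ℕ) : ℝ) = ((N + k : ℕ) : ℝ) + 2 := by push_cast; ring
      rw [e]
      exact this
  intro n hn
  obtain ⟨k, rfl⟩ := Nat.exists_eq_add_of_le hn
  exact (key k).1

theorem exists_norm_sub_le_mul_rpow_of_sq_norm_sub_le {X : Type*} [NormedAddCommGroup X]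
    {u : ℕ → X} {z : X} (hu : Tendsto u atTop (𝓝 z)) {r : ℕ → ℝ} (hr0 : ∀ n, 0 ≤ r n)
    {σ C γ : ℝ} (hσ : 0 < σ) (hC : 0 < C) (hγ : 1 < γ)
    (hdec : ∀ n, σ * ‖u (n + 1) - u n‖ ^ 2 ≤ r n - r (n + 1))
    {N : ℕ} (hN : 1 ≤ N) (hrate : ∀ n : ℕ, N ≤ n → r n ≤ C * (n : ℝ) ^ (-γ)) :
    ∃ K : ℝ, 0 < K ∧ ∀ n : ℕ, N ≤ n → ‖u n - z‖ ≤ K * (n : ℝ) ^ (-((γ - 1) / 2)) := by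
  set p := (γ - 1) / 2 with hp
  have hp0 : 0 < p := by rw [hp]; linarith
  set B := √(C / σ) with hB
  have hBpos : 0 < B := by positivity
  set q := (2 : ℝ) ^ (-p) with hq
  have hq1 : q < 1 := Real.rpow_lt_one_of_one_lt_of_neg (by norm_num) (by linarith)
  have hblock : ∀ m : ℕ, N ≤ m → dist (u m) (u (2 * m)) ≤ B * (m : ℝ) ^ (-p) := by
    intro m hm
    have hm0 : (0 : ℝ) < m := by exact_mod_cast hN.trans hm
    have h1 : dist (u m) (u (2 * m)) ≤
        ∑ i ∈ Finset.range m, ‖u (m + i + 1) - u (m + i)‖ := by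
      have := dist_le_range_sum_dist (fun i => u (m + i)) m
      simp only [add_zero, ← two_mul] at this
      refine this.trans_eq (Finset.sum_congr rfl fun i _ => ?_)
      rw [dist_comm, dist_eq_norm, add_assoc]
    have h2 : (∑ i ∈ Finset.range m, ‖u (m + i + 1) - u (m + i)‖) ^ 2 ≤
        m * ∑ i ∈ Finset.range m, ‖u (m + i + 1) - u (m + i)‖ ^ 2 := by
      simpa using sq_sum_le_card_mul_sum_sq (s := Finset.range m)
        (f := fun i => ‖u (m + i + 1) - u (m + i)‖)
    have h3 : σ * ∑ i ∈ Finset.range m, ‖u (m + i + 1) - u (m + i)‖ ^ 2 ≤ r m := by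
      rw [Finset.mul_sum]
      calc _ ≤ ∑ i ∈ Finset.range m, (r (m + i) - r (m + (i + 1))) :=
            Finset.sum_le_sum fun i _ => hdec (m + i)
        _ = r m - r (m + m) := by
            rw [Finset.sum_range_sub' (fun i => r (m + i))]; simp
        _ ≤ r m := by linarith [hr0 (m + m)]
    have h4 : dist (u m) (u (2 * m)) ^ 2 ≤ m * (C * (m : ℝ) ^ (-γ) / σ) := by
      refine ((pow_le_pow_left₀ dist_nonneg h1 2).trans h2).trans ?_
      gcongr
      rw [le_div_iff₀ hσ, mul_comm]
      exact h3.trans (hrate m hm)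
    have h5 : (B * (m : ℝ) ^ (-p)) ^ 2 = m * (C * (m : ℝ) ^ (-γ) / σ) := by
      rw [mul_pow, hB, Real.sq_sqrt (by positivity), ← Real.rpow_natCast, ← Real.rpow_mul hm0.le]
      have : -p * ((2 : ℕ) : ℝ) = 1 + -γ := by rw [hp]; push_cast; ring
      rw [this, Real.rpow_add hm0, Real.rpow_one]
      ring
    rw [← h5] at h4
    exact (pow_le_pow_iff_left₀ dist_nonneg (by positivity) two_ne_zero).1 h4
  set K := B / (1 - q) with hK
  have hKpos : 0 < K := div_pos hBpos (by linarith)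
  have hKq : B + K * q = K := by
    rw [hK]; field_simp [(by linarith : 1 - q ≠ 0)]; ring
  have hdyad : ∀ j n : ℕ, N ≤ n → dist (u n) (u (2 ^ j * n)) ≤ K * (n : ℝ) ^ (-p) := by
    intro j
    induction j with
    | zero => intro n _; simp; positivity
    | succ j ih =>
      intro n hn
      have h1 := ih (2 * n) (by omega)
      push_cast at h1
      rw [Real.mul_rpow (by norm_num) (by positivity), ← hq] at h1
      calc dist (u n) (u (2 ^ (j + 1) * n))
          ≤ dist (u n) (u (2 * n)) + dist (u (2 * n)) (u (2 ^ j * (2 * n))) := by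
            rw [pow_succ, mul_assoc]; exact dist_triangle _ _ _
        _ ≤ B * (n : ℝ) ^ (-p) + K * (q * (n : ℝ) ^ (-p)) := add_le_add (hblock n hn) h1
        _ = (B + K * q) * (n : ℝ) ^ (-p) := by ring
        _ = _ := by rw [hKq]
  refine ⟨K, hKpos, fun n hn => ?_⟩
  rw [← dist_eq_norm]
  have hsub : Tendsto (fun j : ℕ => 2 ^ j * n) atTop atTop :=
    (tendsto_pow_atTop_atTop_of_one_lt (by norm_num)).atTop_mul_const' (by omega)
  exact le_of_tendsto (tendsto_const_nhds.dist (hu.comp hsub))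
    (Eventually.of_forall fun j => hdyad j n hn)

/-- Local sublinear convergence when the KL exponent `θ ∈ (1/2, 1)`. -/
theorem sublinear_rate_theta_large
    {X : Type*} [NormedAddCommGroup X] [InnerProductSpace ℝ X] [FiniteDimensional ℝ X]
    (H : X → ℝ) (h : X → X) (hH : ∀ x : X, HasGradientAt H (h x) x)
    (hHconv : ConvexOn ℝ Set.univ H)
    (F : X → ℝ) (f : X → X) (hF : ∀ x : X, HasGradientAt F (f x) x)
    (L : ℝ) (hL : 0 < L) (hLip : ∀ x y : X, ‖f x - f y‖ ≤ L * ‖x - y‖)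
    (Lh : ℝ) (hLh : 0 ≤ Lh) (hhLip : ∀ x y : X, ‖h x - h y‖ ≤ Lh * ‖x - y‖)
    (δt : ℝ) (hδt : 0 < δt) (hδt2 : δt < 2 / (3 * L))
    (M : X →L[ℝ] X) (hMsym : ∀ x y : X, ⟪M x, y⟫ = ⟪x, M y⟫)
    (hMpsd : ∀ x : X, 0 ≤ ⟪M x, x⟫)
    (u y : ℕ → X) (lam : ℕ → ℝ) (α : ℝ) (hα : 0 < α)
    (Hn Fn En : ℕ → X → ℝ)
    (hHn : ∀ n : ℕ, ∀ v : X, Hn n v = H v + (1 / δt) * ‖v - u n‖ ^ 2)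
    (hFn : ∀ n : ℕ, ∀ v : X, Fn n v = (1 / (3 * δt)) * ‖v - u (n - 1)‖ ^ 2 - F v
      - ⟪f (u n) - f (u (n - 1)), v - u (n - 1)⟫)
    (hEn : ∀ n : ℕ, ∀ v : X, En n v = Hn n v - Fn n v)
    (hopt : ∀ n : ℕ, gradient (Hn n) (y n) - gradient (Fn n) (u n) + M (y n - u n) = 0)
    (hlam0 : ∀ n : ℕ, 0 ≤ lam n)
    (hls : ∀ n : ℕ, En n (y n + lam n • (y n - u n))
      ≤ En n (y n) - α * lam n * ‖y n - u n‖ ^ 2)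
    (hupd : ∀ n : ℕ, u (n + 1) = y n + lam n • (y n - u n))
    (E : X → ℝ) (hE : ∀ v : X, E v = H v + F v)
    (hlevel : ∀ c : ℝ, Bornology.IsBounded {x : X | E x ≤ c})
    (lamMax : ℝ) (hlamMax : ∀ n : ℕ, lam n ≤ lamMax)
    (hlamBound : lamMax < Real.sqrt (4 / (3 * δt * L) - 1 / 2) - 1)
    (Afun : WithLp 2 (X × X) → ℝ)
    (hAfun : ∀ p : WithLp 2 (X × X),
      Afun p = E (WithLp.equiv 2 (X × X) p).1
        + (L / 2 + 1 / (3 * δt))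
          * ‖(WithLp.equiv 2 (X × X) p).1 - (WithLp.equiv 2 (X × X) p).2‖ ^ 2)
    (ustar : X) (hconv : Tendsto u atTop (𝓝 ustar))
    (θ : ℝ) (hθ : θ ∈ Set.Ioo (1 / 2 : ℝ) 1)
    (hKL : ∀ xbar : WithLp 2 (X × X), gradient Afun xbar = 0 →
      ∃ cbar : ℝ, 0 < cbar ∧ ∃ ε : ℝ, 0 < ε ∧ ∃ ν : ℝ, 0 < ν ∧
        ∀ x : WithLp 2 (X × X), ‖x - xbar‖ ≤ ε → Afun xbar < Afun x →
          Afun x < Afun xbar + ν →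
          cbar * (Afun x - Afun xbar) ^ θ ≤ ‖gradient Afun x‖) :
    ∃ c₂ : ℝ, 0 < c₂ ∧ ∃ n₂ : ℕ,
      ∀ n : ℕ, n₂ < n → ‖u n - ustar‖ ≤ c₂ * (n : ℝ) ^ (-(1 - θ) / (2 * θ - 1)) := by
  obtain ⟨hθ1, hθ2⟩ := hθ
  set e : ℝ := 1 / (3 * δt) with he
  have hepos : 0 < e := by positivity
  have h3e : 1 / δt = 3 * e := by rw [he]; field_simp
  set k : ℝ := L / 2 + e with hk
  have hkpos : 0 < k := by positivity
  have hlamMax0 : 0 ≤ lamMax := (hlam0 0).trans (hlamMax 0)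
  obtain ⟨σ, hσpos, hσ⟩ : ∃ σ : ℝ, 0 < σ ∧
      ∀ n, (σ + L) * (1 + lam n) ^ 2 ≤ 4 * e - L / 2 := by
    have h1 : (1 + lamMax) ^ 2 < 4 / (3 * δt * L) - 1 / 2 :=
      (Real.lt_sqrt (by linarith)).1 (by linarith)
    have h2 : L * (1 + lamMax) ^ 2 < 4 * e - L / 2 := by
      calc L * (1 + lamMax) ^ 2 < L * (4 / (3 * δt * L) - 1 / 2) :=
            mul_lt_mul_of_pos_left h1 hL
        _ = 4 * e - L / 2 := by rw [he]; field_simp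
    have hσpos : 0 < (4 * e - L / 2) / (1 + lamMax) ^ 2 - L := by
      rw [sub_pos, lt_div_iff₀ (by positivity)]
      exact h2
    refine ⟨_, hσpos, fun n => ?_⟩
    rw [sub_add_cancel, div_mul_eq_mul_div, div_le_iff₀ (by positivity)]
    have h3 : 0 ≤ 4 * e - L / 2 := by nlinarith [sq_nonneg (1 + lamMax)]
    have := hlam0 n
    have := hlamMax n
    gcongr
  have hinc : ∀ n, u (n + 1) - u n = (1 + lam n) • (y n - u n) := fun n => by
    rw [hupd, add_smul, one_smul]; abel
  have hstep : ∀ n, h (y n) + (6 * e) • (y n - u n) - ((2 * e) • (u n - u (n - 1)) - f (u n)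
      - (f (u n) - f (u (n - 1)))) + M (y n - u n) = 0 := by
    intro n
    have h1 : HasGradientAt (Hn n) (h (y n) + (6 * e) • (y n - u n)) (y n) := by
      have : Hn n = fun v => H v + (3 * e) * ‖v - u n‖ ^ 2 := by
        funext v; rw [hHn, h3e]
      rw [this, show 6 * e = 2 * (3 * e) by ring]
      exact (hH _).add (hasGradientAt_mul_norm_sub_sq _ _ _)
    have h2 : HasGradientAt (Fn n) ((2 * e) • (u n - u (n - 1)) - f (u n)
        - (f (u n) - f (u (n - 1)))) (u n) := by
      rw [show Fn n = fun v => e * ‖v - u (n - 1)‖ ^ 2 - F v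
        - ⟪f (u n) - f (u (n - 1)), v - u (n - 1)⟫ from funext (hFn n)]
      exact ((hasGradientAt_mul_norm_sub_sq _ _ _).sub (hF _)).sub (hasGradientAt_inner_sub _ _ _)
    have := hopt n
    rwa [h1.gradient, h2.gradient] at this
  have hgrad : ∀ p : WithLp 2 (X × X), gradient Afun p =
      WithLp.toLp 2 (h p.fst + f p.fst + (2 * k) • (p.fst - p.snd),
        -((2 * k) • (p.fst - p.snd))) := by
    intro p
    rw [show Afun = fun q => E q.fst + k * ‖q.fst - q.snd‖ ^ 2 from funext hAfun]
    refine (hasGradientAt_fst_add_mul_norm_sub_sq k p ?_).gradient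
    rw [show E = fun v => H v + F v from funext hE]
    exact (hH _).add (hF _)
  set r : ℕ → ℝ := fun n => Afun (WithLp.toLp 2 (u n, u (n - 1))) - E ustar with hr
  have hA : ∀ a b : X, Afun (WithLp.toLp 2 (a, b)) = E a + k * ‖a - b‖ ^ 2 := fun a b => hAfun _
  have hdec : ∀ n, σ * ‖u (n + 1) - u n‖ ^ 2 ≤ r n - r (n + 1) := by
    intro n
    have hconvH := hHconv.add_inner_gradient_le (hH (y n)) (u n)
    have hFdesc := le_add_inner_add_sq_of_lipschitz_gradient hF hLip (u n) (y n - u n)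
    rw [add_sub_cancel] at hFdesc
    have hl := hls n
    rw [← hupd] at hl
    have hEn' : ∀ v, En n v = E v + 3 * e * ‖v - u n‖ ^ 2
        - (e * ‖v - u (n - 1)‖ ^ 2 - ⟪f (u n) - f (u (n - 1)), v - u (n - 1)⟫) := by
      intro v
      rw [hEn, hHn, hFn, hE, h3e]
      ring
    have hv : ∀ v, v - u (n - 1) = v - u n + (u n - u (n - 1)) := fun v => by abel
    rw [hEn', hEn', hv, hv (y n), hinc, hE (y n)] at hl
    have := lyapunov_decrease (b := u n - u (n - 1)) (p := f (u n)) (q := f (u (n - 1)))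
      (Hu := H (u n)) (Hy := H (y n)) (Fu := F (u n)) (Fy := F (y n)) hepos.le hL.le hα.le
      (hlam0 n) (hσ n) (hstep n) (hMpsd _)
      (by rw [← neg_sub (y n), inner_neg_right] at hconvH; linarith) hFdesc (hLip _ _) hl
    rw [← hinc, ← hk] at this
    simp only [hr, Nat.add_sub_cancel, hA, hE (u n)]
    linarith
  have hanti : Antitone r := antitone_nat_of_succ_le fun n => by
    have := hdec n
    nlinarith [sq_nonneg ‖u (n + 1) - u n‖]
  have hprev : Tendsto (fun n => u (n - 1)) atTop (𝓝 ustar) :=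
    hconv.comp (tendsto_sub_atTop_nat 1)
  have hEcont : ContinuousAt E ustar := by
    rw [show E = fun v => H v + F v from funext hE]
    exact (hH _).differentiableAt.continuousAt.add (hF _).differentiableAt.continuousAt
  have hrlim : Tendsto r atTop (𝓝 0) := by
    have := ((hEcont.tendsto.comp hconv).add
      (((hconv.sub hprev).norm.pow 2).const_mul k)).sub_const (E ustar)
    simpa [hr, hA, Function.comp_def] using this
  have hr0 : ∀ n, 0 ≤ r n := fun n => hanti.le_of_tendsto hrlim n
  obtain ⟨K, hKpos, hK1, hK⟩ : ∃ K : ℝ, 0 < K ∧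
      (∀ n, ‖h (u (n + 2)) + f (u (n + 2))‖
        ≤ K * (‖u (n + 2) - u (n + 1)‖ + ‖u (n + 1) - u n‖)) ∧
      ∀ n, ‖gradient Afun (WithLp.toLp 2 (u (n + 2), u (n + 1)))‖
        ≤ K * (‖u (n + 2) - u (n + 1)‖ + ‖u (n + 1) - u n‖) := by
    have hbound : ∀ n, ‖h (u (n + 2)) + f (u (n + 2))‖
        ≤ (Lh + L + 6 * e + ‖M‖) * ‖u (n + 2) - u (n + 1)‖
          + (L + 2 * e) * ‖u (n + 1) - u n‖ := by
      intro n
      have hs := hstep (n + 1)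
      have hg := hhLip (u (n + 2)) (y (n + 1))
      have hp := hLip (u (n + 2)) (u (n + 1))
      rw [hupd (n + 1), add_sub_cancel_left, ← hupd (n + 1)] at hg
      have hi := hinc (n + 1)
      rw [hi] at hp ⊢
      exact norm_gradient_le_of_step hepos.le hLh (hlam0 _) hs hg hp (hLip _ _)
    refine ⟨Lh + L + 6 * e + ‖M‖ + 4 * k, by positivity, fun n => (hbound n).trans ?_,
      fun n => ?_⟩
    · rw [mul_add]
      have := norm_nonneg M
      exact add_le_add (mul_le_mul_of_nonneg_right (by linarith) (norm_nonneg _))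
        (mul_le_mul_of_nonneg_right (by linarith) (norm_nonneg _))
    · rw [hgrad]
      refine (WithLp.norm_toLp_prod_le _ _).trans ?_
      have h1 := norm_add_le (h (u (n + 2)) + f (u (n + 2))) ((2 * k) • (u (n + 2) - u (n + 1)))
      have h2 : ‖(2 * k) • (u (n + 2) - u (n + 1))‖ = 2 * k * ‖u (n + 2) - u (n + 1)‖ := by
        rw [norm_smul, Real.norm_of_nonneg (by positivity)]
      have h3 : (L + 2 * e) * ‖u (n + 1) - u n‖
          ≤ (Lh + L + 6 * e + ‖M‖ + 4 * k) * ‖u (n + 1) - u n‖ :=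
        mul_le_mul_of_nonneg_right (by linarith [norm_nonneg M]) (norm_nonneg _)
      simp only [WithLp.toLp_fst, WithLp.toLp_snd, norm_neg]
      linarith [hbound n]
  have hcrit : gradient Afun (WithLp.toLp 2 (ustar, ustar)) = 0 := by
    have hhc : Tendsto (fun n => h (u n)) atTop (𝓝 (h ustar)) :=
      ((LipschitzWith.of_dist_le_mul (K := ⟨Lh, hLh⟩)
        (fun x y => by rw [dist_eq_norm, dist_eq_norm]; exact hhLip x y)).continuous.tendsto _).comp hconv
    have hfc : Tendsto (fun n => f (u n)) atTop (𝓝 (f ustar)) :=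
      ((LipschitzWith.of_dist_le_mul (K := ⟨L, hL.le⟩)
        (fun x y => by rw [dist_eq_norm, dist_eq_norm]; exact hLip x y)).continuous.tendsto _).comp hconv
    have h1 := ((hhc.add hfc).norm).comp (tendsto_add_atTop_nat 2)
    have hc1 := hconv.comp (tendsto_add_atTop_nat 1)
    have hc2 := hconv.comp (tendsto_add_atTop_nat 2)
    have h2 := ((hc2.sub hc1).norm.add (hc1.sub hconv).norm).const_mul K
    have h3 := le_of_tendsto_of_tendsto' h1 h2 hK1
    simp only [sub_self, norm_zero, add_zero, mul_zero, norm_le_zero_iff] at h3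
    simp [hgrad, h3]
  obtain ⟨c, hc, ε, hε, ν, hν, hKLx⟩ := hKL _ hcrit
  have hAstar : Afun (WithLp.toLp 2 (ustar, ustar)) = E ustar := by simp [hA]
  have hev : ∀ᶠ n in atTop, ‖u n - ustar‖ + ‖u (n - 1) - ustar‖ < ε ∧ r n < ν := by
    have h1 : Tendsto (fun n => ‖u n - ustar‖ + ‖u (n - 1) - ustar‖) atTop (𝓝 0) := by
      simpa using (hconv.sub_const ustar).norm.add (hprev.sub_const ustar).norm
    exact (h1.eventually_lt_const hε).and (hrlim.eventually_lt_const hν)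
  obtain ⟨N, hN⟩ := eventually_atTop.1 hev
  have hβ : 0 < 2 * θ - 1 := by linarith
  have hrec : ∀ n, N + 1 ≤ n →
      r (n + 2) ^ (1 + (2 * θ - 1)) ≤ 2 * K ^ 2 / (σ * c ^ 2) * (r n - r (n + 2)) := by
    intro n hn
    have hkl : c * r (n + 2) ^ θ
        ≤ K * (‖u (n + 2) - u (n + 1)‖ + ‖u (n + 1) - u n‖) := by
      rcases (hr0 (n + 2)).eq_or_lt with h0 | h0
      · rw [← h0, Real.zero_rpow (by linarith), mul_zero]
        positivity
      · obtain ⟨h1, h2⟩ := hN (n + 2) (by omega)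
        have h3 := hKLx (WithLp.toLp 2 (u (n + 2), u (n + 1))) ?_ ?_ ?_
        · rw [hAstar] at h3
          exact h3.trans (hK n)
        · refine le_trans ?_ h1.le
          exact WithLp.norm_toLp_prod_le (u (n + 2) - ustar) (u (n + 1) - ustar)
        · rw [hAstar]
          exact sub_pos.1 h0
        · rw [hAstar]
          exact sub_lt_iff_lt_add'.1 h2
    have hsq := pow_le_pow_left₀ (mul_nonneg hc.le (Real.rpow_nonneg (hr0 _) _)) hkl 2
    have hpow : (r (n + 2) ^ θ) ^ 2 = r (n + 2) ^ (1 + (2 * θ - 1)) := by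
      rw [← Real.rpow_natCast, ← Real.rpow_mul (hr0 _)]
      congr 1
      push_cast
      ring
    rw [mul_pow, mul_pow, hpow] at hsq
    have h1 := hdec n
    have h2 := hdec (n + 1)
    have h3 : (‖u (n + 2) - u (n + 1)‖ + ‖u (n + 1) - u n‖) ^ 2
        ≤ 2 * ((r n - r (n + 2)) / σ) := by
      have : ‖u (n + 2) - u (n + 1)‖ ^ 2 + ‖u (n + 1) - u n‖ ^ 2
          ≤ (r n - r (n + 2)) / σ := by
        rw [le_div_iff₀ hσpos]
        linarith
      nlinarith [sq_nonneg (‖u (n + 2) - u (n + 1)‖ - ‖u (n + 1) - u n‖)]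
    have h4 : c ^ 2 * r (n + 2) ^ (1 + (2 * θ - 1))
        ≤ K ^ 2 * (2 * ((r n - r (n + 2)) / σ)) := hsq.trans (by gcongr)
    rw [← le_div_iff₀' (by positivity)] at h4
    refine h4.trans_eq ?_
    field_simp
  obtain ⟨C, hC, hrate⟩ := exists_le_mul_rpow_of_rpow_le_sub hanti hβ (by linarith)
    (by positivity) (Nat.succ_pos N) hrec
  obtain ⟨c₂, hc₂, hfinal⟩ := exists_norm_sub_le_mul_rpow_of_sq_norm_sub_le hconv hr0 hσpos hC
    (by rw [lt_div_iff₀ hβ]; linarith) hdec (Nat.succ_pos N) hrate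
  refine ⟨c₂, hc₂, N, fun n hn => (hfinal n hn).trans_eq ?_⟩
  congr 2
  field_simp
  ring
end

section
/- Let (u^n)_{n≥0} (with u^{−1} = u^0) be generated by the algorithm with û^n = ũ^n = (4/3)u^n − (1/3)u^{n−1}: y^n satisfies (2/(3δt))(3y^n − 4u^n + u^{n−1}) + M(y^n − ũ^n) + h(y^n) + 2f(u^n) − f(u^{n−1}) = 0, d^n = y^n − u^n, λ_n ≥ 0 satisfies E^n(y^n + λ_n d^n) ≤ E^n(y^n) − α λ_n ‖d^n‖² (with λ_n = 0 allowed when no positive step exists), and u^{n+1} = y^n + λ_n d^n. Assume E(u) = H(u) + F(u) is bounded below, δt < 2/(3L), and λ_max := sup_n λ_n < min{√((8 − 3δtL)/(6δtL)) − 1, √5 − 1}. Then ∑_{n=1}^∞ ‖u^{n+1} − u^n‖² < ∞. -/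
open scoped RealInnerProductSpace

/-- The derivative of a function along a line, in terms of its gradient. -/
theorem HasGradientAt.hasDerivAt_line {X : Type*} [NormedAddCommGroup X]
    [InnerProductSpace ℝ X] [CompleteSpace X] {F : X → ℝ} {g x d : X} {s : ℝ}
    (hF : HasGradientAt F g (x + s • d)) :
    HasDerivAt (fun s : ℝ => F (x + s • d)) ⟪g, d⟫ s := by
  have hline : HasDerivAt (fun s : ℝ => x + s • d) d s := by
    simpa using ((hasDerivAt_id s).smul_const d).const_add x
  simpa [Function.comp_def] using hF.hasFDerivAt.comp_hasDerivAt s hline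

/-- The descent lemma for a function with Lipschitz continuous gradient. -/
theorem le_add_inner_add_of_lipschitz_gradient {X : Type*} [NormedAddCommGroup X]
    [InnerProductSpace ℝ X] [CompleteSpace X] {F : X → ℝ} {f : X → X} {L : ℝ}
    (hF : ∀ x, HasGradientAt F (f x) x) (hLip : ∀ x y, ‖f x - f y‖ ≤ L * ‖x - y‖) (x d : X) :
    F (x + d) ≤ F x + ⟪f x, d⟫ + L / 2 * ‖d‖ ^ 2 := by
  have hderiv (s : ℝ) : HasDerivAt (fun s : ℝ => F (x + s • d)) ⟪f (x + s • d), d⟫ s :=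
    (hF _).hasDerivAt_line
  have hB (s : ℝ) : HasDerivAt (fun s : ℝ => F x + s * ⟪f x, d⟫ + L / 2 * ‖d‖ ^ 2 * s ^ 2)
      (⟪f x, d⟫ + L * ‖d‖ ^ 2 * s) s := by
    refine ((((hasDerivAt_id s).mul_const ⟪f x, d⟫).const_add (F x)).add
      ((hasDerivAt_pow 2 s).const_mul (L / 2 * ‖d‖ ^ 2))).congr_deriv ?_
    norm_num
    ring
  have key := image_le_of_deriv_right_le_deriv_boundary (a := 0) (b := 1)
    (fun s _ => (hderiv s).continuousAt.continuousWithinAt)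
    (fun s _ => (hderiv s).hasDerivWithinAt) (by simp)
    (fun s _ => (hB s).continuousAt.continuousWithinAt)
    (fun s _ => (hB s).hasDerivWithinAt) ?_ (Set.right_mem_Icc.2 zero_le_one)
  · simpa using key
  · intro s hs
    have hnorm : ‖f (x + s • d) - f x‖ ≤ L * (s * ‖d‖) := by
      simpa [norm_smul, abs_of_nonneg hs.1] using hLip (x + s • d) x
    have hinner := (real_inner_le_norm (f (x + s • d) - f x) d).trans
      (mul_le_mul_of_nonneg_right hnorm (norm_nonneg d))
    rw [inner_sub_left] at hinner
    linarith

/-- A convex function lies above its tangent planes. -/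
theorem ConvexOn.add_inner_le_of_hasGradientAt {X : Type*} [NormedAddCommGroup X]
    [InnerProductSpace ℝ X] [CompleteSpace X] {H : X → ℝ} {g x : X}
    (hconv : ConvexOn ℝ Set.univ H) (hH : HasGradientAt H g x) (d : X) :
    H x + ⟪g, d⟫ ≤ H (x + d) := by
  have hline : ConvexOn ℝ Set.univ (fun s : ℝ => H (x + s • d)) := by
    simpa [Function.comp_def, AffineMap.lineMap_apply, add_comm] using
      hconv.comp_affineMap (AffineMap.lineMap x (x + d) : ℝ →ᵃ[ℝ] X)
  have hderiv : HasDerivAt (fun s : ℝ => H (x + s • d)) ⟪g, d⟫ 0 :=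
    HasGradientAt.hasDerivAt_line (by simpa using hH)
  have hslope := hline.le_slope_of_hasDerivAt (Set.mem_univ 0) (Set.mem_univ 1) one_pos hderiv
  simp only [slope_def_field, zero_smul, one_smul, add_zero, sub_zero, div_one] at hslope
  linarith

/-- Nonnegative terms dominated by the decrements of a sequence bounded below are summable. -/
theorem summable_of_add_mul_le {Φ g : ℕ → ℝ} {ε c : ℝ} (hε : 0 < ε) (hg : ∀ n, 0 ≤ g n)
    (hΦ : ∀ n, c ≤ Φ n) (hstep : ∀ n, Φ (n + 1) + ε * g n ≤ Φ n) : Summable g := by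
  have hsum (n : ℕ) : Φ n + ε * ∑ i ∈ Finset.range n, g i ≤ Φ 0 := by
    induction n with
    | zero => simp
    | succ n ih =>
      rw [Finset.sum_range_succ]
      linarith [hstep n]
  refine summable_of_sum_range_le (c := (Φ 0 - c) / ε) hg fun n => ?_
  rw [le_div_iff₀ hε]
  linarith [hsum n, hΦ n]

/-- Square summability of the iterate increments for the algorithm with
the extrapolated starting point `ûⁿ = ũⁿ = (4/3)uⁿ - (1/3)uⁿ⁻¹` (with the convention
`u⁻¹ = u⁰` encoded by ℕ-subtraction; `λₙ = 0` is allowed by `hlam0`). -/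
theorem square_summable_util
    {X : Type*} [NormedAddCommGroup X] [InnerProductSpace ℝ X] [FiniteDimensional ℝ X]
    (H : X → ℝ) (h : X → X) (hH : ∀ x : X, HasGradientAt H (h x) x)
    (hHconv : ConvexOn ℝ Set.univ H)
    (F : X → ℝ) (f : X → X) (hF : ∀ x : X, HasGradientAt F (f x) x)
    (L : ℝ) (hL : 0 < L) (hLip : ∀ x y : X, ‖f x - f y‖ ≤ L * ‖x - y‖)
    (δt : ℝ) (hδt : 0 < δt) (hδt2 : δt < 2 / (3 * L))
    (M : X →L[ℝ] X) (hMsym : ∀ x y : X, ⟪M x, y⟫ = ⟪x, M y⟫)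
    (hMpsd : ∀ x : X, 0 ≤ ⟪M x, x⟫)
    (u y : ℕ → X) (lam : ℕ → ℝ) (α : ℝ) (hα : 0 < α)
    (Hn Fn En : ℕ → X → ℝ)
    (hHn : ∀ n : ℕ, ∀ v : X, Hn n v = H v + (1 / δt) * ‖v - u n‖ ^ 2)
    (hFn : ∀ n : ℕ, ∀ v : X, Fn n v = (1 / (3 * δt)) * ‖v - u (n - 1)‖ ^ 2 - F v
      - ⟪f (u n) - f (u (n - 1)), v - u (n - 1)⟫)
    (hEn : ∀ n : ℕ, ∀ v : X, En n v = Hn n v - Fn n v)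
    (hopt : ∀ n : ℕ,
      (2 / (3 * δt)) • ((3 : ℝ) • y n - (4 : ℝ) • u n + u (n - 1))
        + M (y n - ((4 / 3 : ℝ) • u n - (1 / 3 : ℝ) • u (n - 1)))
        + h (y n) + (2 : ℝ) • f (u n) - f (u (n - 1)) = 0)
    (hlam0 : ∀ n : ℕ, 0 ≤ lam n)
    (hls : ∀ n : ℕ, En n (y n + lam n • (y n - u n))
      ≤ En n (y n) - α * lam n * ‖y n - u n‖ ^ 2)
    (hupd : ∀ n : ℕ, u (n + 1) = y n + lam n • (y n - u n))
    (E : X → ℝ) (hE : ∀ v : X, E v = H v + F v)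
    (hEbdd : BddBelow (Set.range E))
    (lamMax : ℝ) (hlamMax : ∀ n : ℕ, lam n ≤ lamMax)
    (hlamBound : lamMax <
      min (Real.sqrt ((8 - 3 * δt * L) / (6 * δt * L)) - 1) (Real.sqrt 5 - 1)) :
    Summable (fun n : ℕ => ‖u (n + 1) - u n‖ ^ 2) := by
  obtain ⟨hmax1, hmax2⟩ := lt_min_iff.1 hlamBound
  have hmax0 : 0 ≤ lamMax := (hlam0 0).trans (hlamMax 0)
  obtain ⟨r, hr⟩ : ∃ r, r = 1 / δt := ⟨_, rfl⟩
  have hrpos : 0 < r := by rw [hr]; positivity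
  have hmax_L : L * (1 + lamMax) ^ 2 < 4 * r / 3 - L / 2 := by
    have hsq := (Real.lt_sqrt (by linarith)).1 (lt_sub_iff_add_lt'.1 hmax1)
    rw [lt_div_iff₀ (by positivity)] at hsq
    have hquot : 4 * r / 3 - L / 2 = (8 - 3 * δt * L) / (6 * δt) := by
      rw [hr]
      field_simp
      ring
    rw [hquot, lt_div_iff₀ (by positivity)]
    linarith
  have hmax_five : (1 + lamMax) ^ 2 < 5 :=
    (Real.lt_sqrt (by linarith)).1 (lt_sub_iff_add_lt'.1 hmax2)
  obtain ⟨ε, hε, hεT⟩ : ∃ ε > 0, (ε + L) * (1 + lamMax) ^ 2 ≤ 4 * r / 3 - L / 2 := by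
    refine ⟨(4 * r / 3 - L / 2) / (1 + lamMax) ^ 2 - L, ?_, ?_⟩
    · rw [gt_iff_lt, sub_pos, lt_div_iff₀ (by positivity)]
      exact hmax_L
    · rw [sub_add_cancel, div_mul_cancel₀ _ (by positivity)]
  obtain ⟨c, hc⟩ := hEbdd
  refine summable_of_add_mul_le (Φ := fun n => E (u n) + (r / 3 + L / 2) * ‖u n - u (n - 1)‖ ^ 2
    + 1 / 10 * ⟪M (u n - u (n - 1)), u n - u (n - 1)⟫) (c := c) hε (fun n => by positivity) ?_ ?_
  · intro n
    have hEn_ge : c ≤ E (u n) := hc ⟨u n, rfl⟩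
    have hMn := hMpsd (u n - u (n - 1))
    have : 0 ≤ (r / 3 + L / 2) * ‖u n - u (n - 1)‖ ^ 2 := by positivity
    linarith
  intro n
  obtain ⟨d, hd⟩ : ∃ d, d = y n - u n := ⟨_, rfl⟩
  obtain ⟨a, ha⟩ : ∃ a, a = u n - u (n - 1) := ⟨_, rfl⟩
  obtain ⟨t, ht⟩ : ∃ t, t = 1 + lam n := ⟨_, rfl⟩
  have ht1 : 1 ≤ t := by linarith [hlam0 n]
  have htT : t ^ 2 ≤ (1 + lamMax) ^ 2 := by
    have := hlamMax n
    gcongr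
    linarith
  have hy : y n = u n + d := by rw [hd]; abel
  have hw : u (n + 1) = u n + t • d := by
    rw [hupd, ← hd, hy, ht, add_smul, one_smul, add_assoc]
  have hopt_d := congrArg (fun v => ⟪v, d⟫) (hopt n)
  have hlsn := hls n
  rw [← hupd] at hlsn
  simp only [hEn, hHn, hFn, ← hr] at hlsn
  have hr_third : 1 / (3 * δt) = r / 3 := by rw [hr]; field_simp
  have hr_two_thirds : 2 / (3 * δt) = 2 * r / 3 := by rw [hr]; field_simp
  have hextrap : (3 : ℝ) • y n - (4 : ℝ) • u n + u (n - 1) = (3 : ℝ) • d - a := by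
    rw [hd, ha]; module
  have hMarg : y n - ((4 / 3 : ℝ) • u n - (1 / 3 : ℝ) • u (n - 1)) = d - (1 / 3 : ℝ) • a := by
    rw [hd, ha]; module
  have hnext_prev : u (n + 1) - u (n - 1) = t • d + a := by rw [hw, ha]; abel
  have hy_prev : y n - u (n - 1) = d + a := by rw [hy, ha]; abel
  have hnext : u (n + 1) - u n = t • d := by rw [hw]; abel
  simp only [hextrap, hMarg, hr_two_thirds, inner_add_left, inner_sub_left, inner_smul_left,
    inner_zero_left, map_sub, map_smul, RCLike.conj_to_real, real_inner_self_eq_norm_sq,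
    real_inner_comm d a] at hopt_d
  rw [hnext_prev, hy_prev, hnext, ← hd, hr_third] at hlsn
  simp only [norm_add_sq_real, norm_smul, inner_add_right, inner_smul_right, inner_smul_left,
    RCLike.conj_to_real, inner_sub_left, mul_pow, Real.norm_eq_abs, sq_abs] at hlsn
  have hconv := hHconv.add_inner_le_of_hasGradientAt (hH (y n)) (-d)
  rw [inner_neg_right, show y n + -d = u n by rw [hy]; abel] at hconv
  have hdesc := le_add_inner_add_of_lipschitz_gradient hF hLip (u n) d
  rw [← hy] at hdesc
  have hG : 2 * t * ⟪d, a⟫ ≤ ‖a‖ ^ 2 + t ^ 2 * ‖d‖ ^ 2 := by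
    have := sq_nonneg ‖t • d - a‖
    rw [norm_sub_sq_real, norm_smul, mul_pow, inner_smul_left] at this
    simp only [Real.norm_eq_abs, sq_abs, RCLike.conj_to_real] at this
    linarith
  have hS : -(t * (⟪f (u n), d⟫ - ⟪f (u (n - 1)), d⟫)) ≤ L / 2 * (‖a‖ ^ 2 + t ^ 2 * ‖d‖ ^ 2) := by
    have h1 := (abs_real_inner_le_norm (f (u n) - f (u (n - 1))) d).trans
      (mul_le_mul_of_nonneg_right (hLip (u n) (u (n - 1))) (norm_nonneg d))
    rw [inner_sub_left, ← ha] at h1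
    have h2 := mul_le_mul_of_nonneg_left ((neg_le_abs _).trans h1) (by linarith : 0 ≤ t)
    have h3 := mul_nonneg hL.le (sq_nonneg (‖a‖ - t * ‖d‖))
    linarith
  have hMP : 0 ≤ ⟪M d, d⟫ := hMpsd d
  have hMQ := hMpsd (d - (1 / 3 : ℝ) • a)
  have hMcomm : ⟪M d, a⟫ = ⟪M a, d⟫ := by rw [hMsym, real_inner_comm]
  simp only [map_sub, map_smul, inner_sub_left, inner_sub_right, inner_smul_left,
    inner_smul_right, RCLike.conj_to_real, hMcomm] at hMQ
  have hMR := hMpsd a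
  have hMt : t ^ 2 * ⟪M d, d⟫ ≤ 5 * ⟪M d, d⟫ :=
    mul_le_mul_of_nonneg_right (htT.trans hmax_five.le) hMP
  have hεt : (ε + L) * t ^ 2 * ‖d‖ ^ 2 ≤ (4 * r / 3 - L / 2) * ‖d‖ ^ 2 := by
    refine mul_le_mul_of_nonneg_right (le_trans ?_ hεT) (by positivity)
    gcongr
  have hrG := mul_le_mul_of_nonneg_left hG (by positivity : 0 ≤ r / 3)
  have hαd : 0 ≤ α * lam n * ‖d‖ ^ 2 := by
    have := hlam0 n
    positivity
  simp only [Nat.add_sub_cancel, hnext, ← ha, hE, norm_smul, mul_pow, Real.norm_eq_abs, sq_abs,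
    map_smul, inner_smul_left, inner_smul_right, RCLike.conj_to_real]
  linarith
end
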